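/- For every list of columns s = [a_1, …, a_p] : List (Fin n), the iteration defined by L_0 := (fun _ => 0) and L_{t+1} := Refine(L_t, a_{t+1}) satisfies L_t = rk_{[a_1,…,a_t]} for every 0 ≤ t ≤ p; in particular List.foldl (fun L i => Refine(L, i)) (fun _ => 0) s = rk_s, the unique ranking vector of the lexicographical sorting of the sub-matrix of D determined by the sequence of columns s. -/

import Mathlib

open scoped Classical

noncomputable def key {m n : ℕ} (D : Fin m → Fin n → ℝ) (s : List (Fin n)) (j : Fin m) :
    List ℝ := s.map (fun a => D j a)

noncomputable def rk {m n : ℕ} (D : Fin m → Fin n → ℝ) (s : List (Fin n)) (j : Fin m) : ℕ :=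
  ((Finset.univ.image (key D s)).filter (fun v => List.Lex (· < ·) v (key D s j))).card

noncomputable def subID {m n : ℕ} (D : Fin m → Fin n → ℝ) (L : Fin m → ℕ) (i : Fin n)
    (j : Fin m) : ℕ :=
  ((Finset.univ.filter (fun k => L k = L j ∧ D k i < D j i)).image (fun k => D k i)).card

noncomputable def newCount {m n : ℕ} (D : Fin m → Fin n → ℝ) (L : Fin m → ℕ) (i : Fin n)
    (r : ℕ) : ℕ :=
  if (Finset.univ.filter (fun k => L k = r)).Nonempty then
    ((Finset.univ.filter (fun k => L k = r)).image (fun k => D k i)).card - 1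
  else 0

noncomputable def numNewID {m n : ℕ} (D : Fin m → Fin n → ℝ) (L : Fin m → ℕ) (i : Fin n)
    (r : ℕ) : ℕ :=
  ∑ l ∈ Finset.range r, newCount D L i l

noncomputable def Refine {m n : ℕ} (D : Fin m → Fin n → ℝ) (L : Fin m → ℕ) (i : Fin n)
    (j : Fin m) : ℕ :=
  L j + numNewID D L i (L j) + subID D L i j

theorem key_append_singleton {m n : ℕ} (D : Fin m → Fin n → ℝ) (s : List (Fin n)) (i : Fin n)
    (j : Fin m) : key D (s ++ [i]) j = key D s j ++ [D j i] := by
  simp [key]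

theorem List.append_singleton_lt_append_singleton {α : Type*} [LinearOrder α] {l l' : List α}
    (h : l.length = l'.length) (a b : α) :
    l ++ [a] < l' ++ [b] ↔ l < l' ∨ l = l' ∧ a < b := by
  induction l generalizing l' with
  | nil =>
    obtain rfl : l' = [] := List.length_eq_zero_iff.mp h.symm
    simp [List.cons_lt_cons_iff]
  | cons x l ih =>
    cases l' with
    | nil => simp at h
    | cons y l' =>
      simp only [List.length_cons, Nat.add_right_cancel_iff] at h
      simp only [List.cons_append, List.cons_lt_cons_iff, ih h, List.cons.injEq]
      tauto

theorem key_append_singleton_lt {m n : ℕ} (D : Fin m → Fin n → ℝ) (s : List (Fin n)) (i : Fin n)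
    (k j : Fin m) : key D (s ++ [i]) k < key D (s ++ [i]) j ↔
      key D s k < key D s j ∨ key D s k = key D s j ∧ D k i < D j i := by
  rw [key_append_singleton, key_append_singleton]
  exact List.append_singleton_lt_append_singleton (by simp [key]) _ _

theorem Finset.card_filter_lt_strictMonoOn {α : Type*} [LinearOrder α] [DecidableLT α]
    (K : Finset α) :
    StrictMonoOn (fun w => (K.filter (· < w)).card) K := by
  intro v hv w _ hvw
  apply Finset.card_lt_card
  refine Finset.ssubset_iff_of_subset ?_ |>.mpr ⟨v, ?_, ?_⟩
  · intro x hx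
    simp only [Finset.mem_filter] at hx ⊢
    exact ⟨hx.1, hx.2.trans hvw⟩
  · simpa using ⟨hv, hvw⟩
  · simp

theorem Finset.image_card_filter_lt {α : Type*} [LinearOrder α] [DecidableLT α] (K : Finset α)
    {a : α} (ha : a ∈ K) :
    (K.filter (· < a)).image (fun w => (K.filter (· < w)).card) =
      Finset.range (K.filter (· < a)).card := by
  apply Finset.eq_of_subset_of_card_le
  · intro l hl
    obtain ⟨w, hw, rfl⟩ := Finset.mem_image.mp hl
    rw [Finset.mem_filter] at hw
    exact Finset.mem_range.mpr (K.card_filter_lt_strictMonoOn hw.1 ha hw.2)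
  · rw [Finset.card_range, Finset.card_image_of_injOn]
    exact K.card_filter_lt_strictMonoOn.injOn.mono (Finset.coe_subset.mpr (Finset.filter_subset _ _))

theorem rk_eq_card {m n : ℕ} (D : Fin m → Fin n → ℝ) (s : List (Fin n)) (j : Fin m) :
    rk D s j = ((Finset.univ.image (key D s)).filter (· < key D s j)).card := by
  unfold rk
  congr!

theorem rk_eq_rk_iff {m n : ℕ} (D : Fin m → Fin n → ℝ) (s : List (Fin n)) (k j : Fin m) :
    rk D s k = rk D s j ↔ key D s k = key D s j := by
  rw [rk_eq_card, rk_eq_card]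
  exact (Finset.univ.image (key D s)).card_filter_lt_strictMonoOn.injOn.eq_iff
    (Finset.mem_image_of_mem _ (Finset.mem_univ k)) (Finset.mem_image_of_mem _ (Finset.mem_univ j))

theorem newCount_rk_add_one {m n : ℕ} (D : Fin m → Fin n → ℝ) (s : List (Fin n)) (i : Fin n)
    (j : Fin m) :
    newCount D (rk D s) i (rk D s j) + 1 =
      ((Finset.univ.filter (fun k => key D s k = key D s j)).image (fun k => D k i)).card := by
  have hne : (Finset.univ.filter (fun k => key D s k = key D s j)).Nonempty := ⟨j, by simp⟩
  simp only [newCount, rk_eq_rk_iff, if_pos hne]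
  exact Nat.sub_add_cancel (hne.image _).card_pos

theorem rk_add_numNewID_rk {m n : ℕ} (D : Fin m → Fin n → ℝ) (s : List (Fin n)) (i : Fin n)
    (j : Fin m) :
    rk D s j + numNewID D (rk D s) i (rk D s j) =
      ∑ w ∈ (Finset.univ.image (key D s)).filter (· < key D s j),
        ((Finset.univ.filter (fun k => key D s k = w)).image (fun k => D k i)).card := by
  have hcard : rk D s j = ∑ l ∈ Finset.range (rk D s j), 1 := by simp
  unfold numNewID
  conv_lhs => enter [1]; rw [hcard]
  rw [← Finset.sum_add_distrib, rk_eq_card, 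
    ← (Finset.univ.image (key D s)).image_card_filter_lt
      (Finset.mem_image_of_mem _ (Finset.mem_univ j)),
    Finset.sum_image]
  · refine Finset.sum_congr rfl fun w hw => ?_
    obtain ⟨k, -, rfl⟩ := Finset.mem_image.mp (Finset.mem_filter.mp hw).1
    rw [← rk_eq_card, add_comm, newCount_rk_add_one]
  · exact (Finset.card_filter_lt_strictMonoOn _).injOn.mono
      (Finset.coe_subset.mpr (Finset.filter_subset _ _))

theorem card_image_key_append_singleton {m n : ℕ} (D : Fin m → Fin n → ℝ) (s : List (Fin n))
    (i : Fin n) (w : List ℝ) (P : Finset (Fin m)) (hP : ∀ k ∈ P, key D s k = w) :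
    (P.image (key D (s ++ [i]))).card = (P.image (fun k => D k i)).card := by
  have hinj : Function.Injective (fun x : ℝ => w ++ [x]) := fun x y h => by simpa using h
  rw [← Finset.card_image_of_injective _ hinj, Finset.image_image]
  congr 1
  refine Finset.image_congr fun k hk => ?_
  simp [key_append_singleton, hP k hk]

theorem card_image_key_append_singleton_of_lt {m n : ℕ} (D : Fin m → Fin n → ℝ)
    (s : List (Fin n)) (i : Fin n) (j : Fin m) :
    ((Finset.univ.filter (fun k => key D s k < key D s j)).image (key D (s ++ [i]))).card =
      ∑ w ∈ (Finset.univ.image (key D s)).filter (· < key D s j),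
        ((Finset.univ.filter (fun k => key D s k = w)).image (fun k => D k i)).card := by
  rw [Finset.card_eq_sum_card_fiberwise (f := List.dropLast)
    (t := (Finset.univ.image (key D s)).filter (· < key D s j))]
  · refine Finset.sum_congr rfl fun w hw => ?_
    rw [← card_image_key_append_singleton D s i w _ (by simp), Finset.filter_image,
      Finset.filter_filter]
    congr 2
    ext k
    simp only [Finset.mem_filter, Finset.mem_univ, true_and, key_append_singleton,
      List.dropLast_concat, and_iff_right_iff_imp]
    rintro rfl
    exact (Finset.mem_filter.mp hw).2
  · intro v hv
    obtain ⟨k, hk, rfl⟩ := Finset.mem_image.mp hv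
    simpa [key_append_singleton] using hk

theorem Refine_rk {m n : ℕ} (D : Fin m → Fin n → ℝ) (s : List (Fin n)) (i : Fin n) :
    Refine D (rk D s) i = rk D (s ++ [i]) := by
  funext j
  rw [Refine, rk_add_numNewID_rk, ← card_image_key_append_singleton_of_lt, rk_eq_card,
    Finset.filter_image]
  simp only [key_append_singleton_lt, subID, rk_eq_rk_iff]
  rw [Finset.filter_or, Finset.image_union, Finset.card_union_of_disjoint,
    card_image_key_append_singleton D s i (key D s j)
      (Finset.univ.filter fun k => key D s k = key D s j ∧ D k i < D j i) (by simp +contextual)]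
  rw [Finset.disjoint_left]
  intro v hv hv'
  obtain ⟨k, hk, rfl⟩ := Finset.mem_image.mp hv
  obtain ⟨l, hl, h⟩ := Finset.mem_image.mp hv'
  simp only [Finset.mem_filter, Finset.mem_univ, true_and] at hk hl
  rw [key_append_singleton, key_append_singleton] at h
  have hlk : key D s l = key D s k := (List.append_inj' h rfl).1
  exact hk.ne (hlk.symm.trans hl.1)

theorem foldl_Refine_eq {m n : ℕ} (D : Fin m → Fin n → ℝ) (s : List (Fin n)) :
    List.foldl (fun L i => Refine D L i) (fun _ => 0) s = rk D s := by
  induction s using List.reverseRecOn with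
  | nil =>
    funext j
    simp [rk, key, Finset.filter_image]
  | append_singleton s i ih => rw [List.foldl_append, ih, List.foldl_cons, List.foldl_nil, Refine_rk]

theorem foldl_refine_eq_rk {m n : ℕ} (hm : 1 ≤ m)
    (D : Fin m → Fin n → ℝ) (s : List (Fin n)) :
    (∀ t ≤ s.length,
        List.foldl (fun L i => Refine D L i) (fun _ => 0) (s.take t) = rk D (s.take t)) ∧
    List.foldl (fun L i => Refine D L i) (fun _ => 0) s = rk D s :=
  ⟨fun t _ => foldl_Refine_eq D (s.take t), foldl_Refine_eq D s⟩
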